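/- arXiv:1412.4840 — 2 statements merged into one kernel-verified Lean document; each statement's English description precedes it below -/
import Mathlib

section
/- There exists a dynamic (U,V) for the 2×2 identity matrix I_2 (the 'main dynamic for I_2') such that for every k ≥ 1, U(2k(2k−1)) = (k(2k−1), k(2k−1)), and V(2k(2k−1)) = ((k−1)(2k−1), (k+1)(2k−1)) when k is odd, while V(2k(2k−1)) = ((k+1)(2k−1), (k−1)(2k−1)) when k is even. In particular gap(2k(2k−1)) = 2k−1 for all k ≥ 1. -/
/-- A dynamic for the `n × n` identity matrix `Iₙ`: sequences `U V : ℕ → Fin n → ℕ`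
starting at the zero vectors such that at each step `t` there are indices `i`, `j`
with `V i t` maximal in `V t` and `U j t` minimal in `U t`, and `U` is incremented
by `e_i` while `V` is incremented by `e_j`. -/
def IsDynamic (n : ℕ) (U V : ℕ → Fin n → ℕ) : Prop :=
  (∀ l, U 0 l = 0) ∧ (∀ l, V 0 l = 0) ∧
  ∀ t, ∃ i j : Fin n,
    (∀ l, V t l ≤ V t i) ∧ (∀ l, U t j ≤ U t l) ∧
    (∀ l, U (t + 1) l = U t l + if l = i then 1 else 0) ∧
    (∀ l, V (t + 1) l = V t l + if l = j then 1 else 0)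

/-- The duality gap of a dynamic at step `t`: `max_l V l t − min_l U l t`. -/
noncomputable def gap (n : ℕ) (U V : ℕ → Fin n → ℕ) (t : ℕ) : ℤ :=
  ((⨆ l, V t l : ℕ) : ℤ) - ((⨅ l, U t l : ℕ) : ℤ)

/-- One step of fictitious play on `I₂`, on states `(U₀, U₁, V₀, V₁)`. A tie in `V` is broken
towards the larger coordinate of `U`, and a tie in `U` towards the larger coordinate of `V`. -/
def playStep (s : ℕ × ℕ × ℕ × ℕ) : ℕ × ℕ × ℕ × ℕ :=
  let first := s.2.2.2 < s.2.2.1 ∨ (s.2.2.1 = s.2.2.2 ∧ s.2.1 ≤ s.1)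
  let second := s.1 < s.2.1 ∨ (s.1 = s.2.1 ∧ s.2.2.2 < s.2.2.1)
  (s.1 + (if first then 1 else 0), s.2.1 + (if first then 0 else 1),
    s.2.2.1 + (if second then 1 else 0), s.2.2.2 + (if second then 0 else 1))

/-- The state of the main dynamic for `I₂` after `t` steps. -/
def mainState (t : ℕ) : ℕ × ℕ × ℕ × ℕ := playStep^[t] (0, 0, 0, 0)

lemma mainState_succ (t : ℕ) : mainState (t + 1) = playStep (mainState t) :=
  Function.iterate_succ_apply' _ _ _

/-- The `U`-component of the main dynamic for `I₂`. -/
def mainU (t : ℕ) : Fin 2 → ℕ := ![(mainState t).1, (mainState t).2.1]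

/-- The `V`-component of the main dynamic for `I₂`. -/
def mainV (t : ℕ) : Fin 2 → ℕ := ![(mainState t).2.2.1, (mainState t).2.2.2]

lemma isDynamic_main : IsDynamic 2 mainU mainV := by
  refine ⟨by simp [Fin.forall_fin_two, mainU, mainState],
    by simp [Fin.forall_fin_two, mainV, mainState], fun t => ?_⟩
  rcases h : mainState t with ⟨a, b, c, d⟩
  refine ⟨if d < c ∨ (c = d ∧ b ≤ a) then 0 else 1,
    if a < b ∨ (a = b ∧ d < c) then 0 else 1, ?_⟩
  simp only [Fin.forall_fin_two, mainU, mainV, mainState_succ, h, playStep]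
  by_cases h₁ : d < c ∨ (c = d ∧ b ≤ a) <;> by_cases h₂ : a < b ∨ (a = b ∧ d < c) <;>
    simp only [h₁, h₂, if_true, if_false] <;> simp <;> omega

/-- While `U₀ < U₁` and `V₀ ≤ V₁`, the coordinates `U₁` and `V₀` grow. -/
lemma iterate_playStep_of_lt_of_le (n : ℕ) {a b c d : ℕ} (hU : a < b) (hV : c + n ≤ d + 1) :
    playStep^[n] (a, b, c, d) = (a, b + n, c + n, d) := by
  induction n with
  | zero => rfl
  | succ n ih =>
    rw [Function.iterate_succ_apply', ih (by omega)]
    simp only [playStep, Prod.mk.injEq]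
    split_ifs <;> omega

/-- While `U₁ < U₀` and `V₁ ≤ V₀`, the coordinates `U₀` and `V₁` grow. -/
lemma iterate_playStep_of_gt_of_ge (n : ℕ) {a b c d : ℕ} (hU : b < a) (hV : d + n ≤ c + 1) :
    playStep^[n] (a, b, c, d) = (a + n, b, c, d + n) := by
  induction n with
  | zero => rfl
  | succ n ih =>
    rw [Function.iterate_succ_apply', ih (by omega)]
    simp only [playStep, Prod.mk.injEq]
    split_ifs <;> omega

/-- While `U₀ < U₁` and `V₁ < V₀`, the coordinates `U₀` and `V₀` grow. -/
lemma iterate_playStep_of_lt_of_gt (n : ℕ) {a b c d : ℕ} (hU : a + n ≤ b) (hV : d < c) :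
    playStep^[n] (a, b, c, d) = (a + n, b, c + n, d) := by
  induction n with
  | zero => rfl
  | succ n ih =>
    rw [Function.iterate_succ_apply', ih (by omega)]
    simp only [playStep, Prod.mk.injEq]
    split_ifs <;> omega

/-- While `U₁ < U₀` and `V₀ < V₁`, the coordinates `U₁` and `V₁` grow. -/
lemma iterate_playStep_of_gt_of_lt (n : ℕ) {a b c d : ℕ} (hU : b + n ≤ a) (hV : c < d) :
    playStep^[n] (a, b, c, d) = (a, b + n, c, d + n) := by
  induction n with
  | zero => rfl
  | succ n ih =>
    rw [Function.iterate_succ_apply', ih (by omega)]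
    simp only [playStep, Prod.mk.injEq]
    split_ifs <;> omega

/-- Passage from a tie in `U` with `V₀ < V₁` to the next tie in `U`. -/
lemma iterate_playStep_tie_of_lt (m a c : ℕ) (hc : 0 < c) :
    playStep^[2 * c + 6] (m, m, a, a + c) = (m + c + 3, m + c + 3, a + 2 * c + 5, a + c + 1) := by
  have h : playStep (m, m, a, a + c) = (m, m + 1, a, a + c + 1) := by
    simp only [playStep, Prod.mk.injEq, true_and]
    split_ifs <;> omega
  rw [show 2 * c + 6 = (c + 3) + (c + 2) + 1 by ring, Function.iterate_succ_apply, h,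
    Function.iterate_add_apply, iterate_playStep_of_lt_of_le (c + 2) (by omega) (by omega),
    iterate_playStep_of_lt_of_gt (c + 3) (by omega) (by omega)]
  simp only [Prod.mk.injEq, and_true]
  omega

/-- Passage from a tie in `U` with `V₁ < V₀` to the next tie in `U`. -/
lemma iterate_playStep_tie_of_gt (m a c : ℕ) (hc : 0 < c) :
    playStep^[2 * c + 6] (m, m, a + c, a) = (m + c + 3, m + c + 3, a + c + 1, a + 2 * c + 5) := by
  have h : playStep (m, m, a + c, a) = (m + 1, m, a + c + 1, a) := by
    simp only [playStep, Prod.mk.injEq, true_and]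
    split_ifs <;> omega
  rw [show 2 * c + 6 = (c + 3) + (c + 2) + 1 by ring, Function.iterate_succ_apply, h,
    Function.iterate_add_apply, iterate_playStep_of_gt_of_ge (c + 2) (by omega) (by omega),
    iterate_playStep_of_gt_of_lt (c + 3) (by omega) (by omega)]
  simp only [Prod.mk.injEq, true_and]
  omega

lemma mainState_tie (n : ℕ) :
    mainState (2 * (n + 1) * (2 * n + 1)) =
      if Even n then
        ((n + 1) * (2 * n + 1), (n + 1) * (2 * n + 1), n * (2 * n + 1), (n + 2) * (2 * n + 1))
      else
        ((n + 1) * (2 * n + 1), (n + 1) * (2 * n + 1), (n + 2) * (2 * n + 1), n * (2 * n + 1)) := by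
  induction n with
  | zero => rfl
  | succ n ih =>
    have ht : 2 * (n + 1 + 1) * (2 * (n + 1) + 1) =
        (2 * (2 * (2 * n + 1)) + 6) + 2 * (n + 1) * (2 * n + 1) := by ring
    have hd : (n + 2) * (2 * n + 1) = n * (2 * n + 1) + 2 * (2 * n + 1) := by ring
    rw [mainState] at ih
    rw [mainState, ht, Function.iterate_add_apply, ih, hd]
    by_cases hn : Even n
    · rw [if_pos hn, if_neg (by simpa [Nat.even_add_one] using hn),
        iterate_playStep_tie_of_lt _ _ _ (by omega)]
      simp only [Prod.mk.injEq]
      refine ⟨?_, ?_, ?_, ?_⟩ <;> ring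
    · rw [if_neg hn, if_pos (by simpa [Nat.even_add_one] using hn),
        iterate_playStep_tie_of_gt _ _ _ (by omega)]
      simp only [Prod.mk.injEq]
      refine ⟨?_, ?_, ?_, ?_⟩ <;> ring

lemma gap_two (U V : ℕ → Fin 2 → ℕ) (t : ℕ) :
    gap 2 U V t = (max (V t 0) (V t 1) : ℕ) - (min (U t 0) (U t 1) : ℕ) := by
  have hV : ⨆ l, V t l = max (V t 0) (V t 1) := by
    apply le_antisymm
    · exact ciSup_le (by simp [Fin.forall_fin_two])
    · exact max_le (le_ciSup (Set.finite_range _).bddAbove 0)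
        (le_ciSup (Set.finite_range _).bddAbove 1)
  have hU : ⨅ l, U t l = min (U t 0) (U t 1) := by
    apply le_antisymm
    · exact le_min (ciInf_le (OrderBot.bddBelow _) 0) (ciInf_le (OrderBot.bddBelow _) 1)
    · exact le_ciInf (by simp [Fin.forall_fin_two])
  rw [gap, hV, hU]

/-- There exists a dynamic `(U, V)` for `I₂` (the main dynamic for `I₂`) such that
for every `k ≥ 1`, `U(2k(2k−1)) = (k(2k−1), k(2k−1))`,
`V(2k(2k−1)) = ((k−1)(2k−1), (k+1)(2k−1))` for odd `k` and
`V(2k(2k−1)) = ((k+1)(2k−1), (k−1)(2k−1))` for even `k`; in particular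
`gap(2k(2k−1)) = 2k−1`. -/
theorem stmt_6 :
    ∃ U V : ℕ → Fin 2 → ℕ, IsDynamic 2 U V ∧
      ∀ k : ℕ, 1 ≤ k →
        (U (2 * k * (2 * k - 1)) 0 = k * (2 * k - 1) ∧
         U (2 * k * (2 * k - 1)) 1 = k * (2 * k - 1)) ∧
        (Odd k →
          V (2 * k * (2 * k - 1)) 0 = (k - 1) * (2 * k - 1) ∧
          V (2 * k * (2 * k - 1)) 1 = (k + 1) * (2 * k - 1)) ∧
        (Even k →
          V (2 * k * (2 * k - 1)) 0 = (k + 1) * (2 * k - 1) ∧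
          V (2 * k * (2 * k - 1)) 1 = (k - 1) * (2 * k - 1)) ∧
        gap 2 U V (2 * k * (2 * k - 1)) = 2 * (k : ℤ) - 1 := by
  refine ⟨mainU, mainV, isDynamic_main, fun k hk => ?_⟩
  obtain ⟨n, rfl⟩ := Nat.exists_eq_add_of_le' hk
  have h := mainState_tie n
  have hs : 2 * (n + 1) - 1 = 2 * n + 1 := by omega
  have hle : n * (2 * n + 1) ≤ (n + 2) * (2 * n + 1) := Nat.mul_le_mul_right _ (by omega)
  rw [gap_two, hs]
  by_cases hn : Even n
  · rw [if_pos hn] at h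
    have hk : Odd (n + 1) := hn.add_one
    simp only [mainU, mainV, h, Matrix.cons_val_zero, Matrix.cons_val_one, max_eq_right hle,
      min_self]
    refine ⟨⟨trivial, trivial⟩, fun _ => ⟨rfl, trivial⟩, fun he => absurd hk (Nat.not_odd_iff_even.2 he), ?_⟩
    push_cast
    ring
  · rw [if_neg hn] at h
    have hk : Even (n + 1) := (Nat.not_even_iff_odd.1 hn).add_one
    simp only [mainU, mainV, h, Matrix.cons_val_zero, Matrix.cons_val_one, max_eq_left hle,
      min_self]
    refine ⟨⟨trivial, trivial⟩, fun ho => absurd hk (Nat.not_even_iff_odd.2 ho), fun _ => ⟨trivial, rfl⟩, ?_⟩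
    push_cast
    ring
end

section
/- For every natural number T ≥ 1, let k be the largest natural number with k(2k−1) ≤ T. Then there exists a dynamic (U,V) for the 2×2 identity matrix I_2 such that U(2T) = (T, T) and the multiset of components of V(2T) equals {T − (2k−1), T + (2k−1)}; in particular gap(2T) = 2k−1. -/
/-- One legal step of fictitious play on `Iₙ`, from the state `p = (U, V)` to the state `q`. -/
def IsStep {n : ℕ} (p q : (Fin n → ℕ) × (Fin n → ℕ)) : Prop :=
  ∃ i j : Fin n, (∀ l, p.2 l ≤ p.2 i) ∧ (∀ l, p.1 j ≤ p.1 l) ∧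
    (∀ l, q.1 l = p.1 l + if l = i then 1 else 0) ∧
    (∀ l, q.2 l = p.2 l + if l = j then 1 else 0)

theorem exists_isStep {n : ℕ} [NeZero n] (p : (Fin n → ℕ) × (Fin n → ℕ)) :
    ∃ q, IsStep p q := by
  obtain ⟨i, hi⟩ := Finite.exists_max p.2
  obtain ⟨j, hj⟩ := Finite.exists_min p.1
  exact ⟨(fun l => p.1 l + if l = i then 1 else 0, fun l => p.2 l + if l = j then 1 else 0),
    i, j, hi, hj, fun _ => rfl, fun _ => rfl⟩

/-- Any legal step from a state of a dynamic is the next step of some dynamic through it. -/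
theorem IsDynamic.exists_extend {n : ℕ} [NeZero n] {U V : ℕ → Fin n → ℕ}
    (h : IsDynamic n U V) (t : ℕ) (z : (Fin n → ℕ) × (Fin n → ℕ))
    (hz : IsStep (U t, V t) z) :
    ∃ U' V', IsDynamic n U' V' ∧ U' (t + 1) = z.1 ∧ V' (t + 1) = z.2 := by
  choose next hnext using exists_isStep (n := n)
  let f : ℕ → (Fin n → ℕ) × (Fin n → ℕ) :=
    fun m => if m ≤ t then (U m, V m) else next^[m - (t + 1)] z
  have hstep : ∀ m, IsStep (f m) (f (m + 1)) := by
    intro m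
    rcases lt_trichotomy m t with hm | rfl | hm
    · have h₁ : f m = (U m, V m) := if_pos hm.le
      have h₂ : f (m + 1) = (U (m + 1), V (m + 1)) := if_pos hm
      rw [h₁, h₂]
      exact h.2.2 m
    · have h₁ : f m = (U m, V m) := if_pos le_rfl
      have h₂ : f (m + 1) = z := by simp [f]
      rwa [h₁, h₂]
    · have h₁ : f m = next^[m - (t + 1)] z := if_neg (by omega)
      have h₂ : f (m + 1) = next (f m) := by
        rw [h₁, ← Function.iterate_succ_apply' next,
          show (m - (t + 1)).succ = m + 1 - (t + 1) by omega]
        exact if_neg (by omega)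
      rw [h₂]
      exact hnext _
  have h₀ : f 0 = (U 0, V 0) := if_pos (Nat.zero_le t)
  have h₁ : f (t + 1) = z := by simp [f]
  exact ⟨fun m => (f m).1, fun m => (f m).2,
    ⟨fun l => by simp [h₀, h.1 l], fun l => by simp [h₀, h.2.1 l], hstep⟩,
    by simp [h₁], by simp [h₁]⟩

/-- Some dynamic for `I₂` is at `U = (a, b)`, `V = (c, d)` at time `t`. -/
def Reachable (t a b c d : ℕ) : Prop :=
  ∃ U V, IsDynamic 2 U V ∧ U t = ![a, b] ∧ V t = ![c, d]

namespace Reachable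

theorem zero : Reachable 0 0 0 0 0 := by
  choose next hnext using exists_isStep (n := 2)
  refine ⟨fun m => (next^[m] (![0, 0], ![0, 0])).1, fun m => (next^[m] (![0, 0], ![0, 0])).2,
    ⟨by simp, by simp, fun t => ?_⟩, rfl, rfl⟩
  simp only [Function.iterate_succ_apply']
  exact hnext _

variable {t a b c d : ℕ}

theorem swap (h : Reachable t a b c d) : Reachable t b a d c := by
  obtain ⟨U, V, ⟨hU, hV, hs⟩, hUt, hVt⟩ := h
  refine ⟨fun t l => U t l.rev, fun t l => V t l.rev,
    ⟨fun l => hU _, fun l => hV _, fun t => ?_⟩, ?_, ?_⟩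
  · obtain ⟨i, j, hi, hj, hu, hv⟩ := hs t
    refine ⟨i.rev, j.rev, by simp [hi], by simp [hj],
      fun l => ?_, fun l => ?_⟩
    · simp [hu, Fin.rev_eq_iff]
    · simp [hv, Fin.rev_eq_iff]
  · ext l; fin_cases l <;> simp [hUt, Fin.rev]
  · ext l; fin_cases l <;> simp [hVt, Fin.rev]

theorem inward (h : Reachable t a b c d) (hV : d ≤ c) (hU : b ≤ a) :
    Reachable (t + 1) (a + 1) b c (d + 1) := by
  obtain ⟨U, V, hD, hUt, hVt⟩ := h
  refine hD.exists_extend t (![a + 1, b], ![c, d + 1]) ⟨0, 1, ?_⟩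
  simp [hUt, hVt, Fin.forall_fin_two, hV, hU]

theorem outward (h : Reachable t a b c d) (hV : d ≤ c) (hU : a ≤ b) :
    Reachable (t + 1) (a + 1) b (c + 1) d := by
  obtain ⟨U, V, hD, hUt, hVt⟩ := h
  refine hD.exists_extend t (![a + 1, b], ![c + 1, d]) ⟨0, 0, ?_⟩
  simp [hUt, hVt, Fin.forall_fin_two, hV, hU]

/-- The run of steps until the components of `V` agree. -/
theorem run_to_tie_snd (m : ℕ) (h : Reachable t a b (d + m) d) (hU : b ≤ a) :
    Reachable (t + m) (a + m) b (d + m) (d + m) := by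
  induction m generalizing t a d with
  | zero => exact h
  | succ m ih =>
    have := ih (t := t + 1) (a := a + 1) (d := d + 1)
      (by convert h.inward (by omega) hU using 1; omega) (by omega)
    convert this using 1 <;> omega

/-- The run of steps until the components of `U` agree. -/
theorem run_to_tie_fst (m : ℕ) (h : Reachable t (b + m) b c d) (hV : c ≤ d) :
    Reachable (t + m) (b + m) (b + m) c (d + m) := by
  induction m generalizing t b d with
  | zero => exact h
  | succ m ih =>
    have := ih (t := t + 1) (b := b + 1) (d := d + 1)
      (by convert (h.swap.outward hV (by omega)).swap using 1; omega) (by omega)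
    convert this using 1 <;> omega

end Reachable

/-- The tied states with spread `2 * s` and minimum `r` are reachable. -/
def TiesReachable (r s : ℕ) : Prop :=
  Reachable (2 * (r + s)) (r + 2 * s) r (r + s) (r + s) ∧
    Reachable (2 * (r + s)) (r + s) (r + s) (r + 2 * s) r

namespace TiesReachable

theorem zero : TiesReachable 0 0 := ⟨Reachable.zero, Reachable.zero⟩

variable {r s : ℕ}

theorem rotate (h : TiesReachable r s) : TiesReachable (r + s) s := by
  constructor
  · convert h.2.run_to_tie_snd (2 * s) le_rfl using 1 <;> omega
  · convert (h.1.run_to_tie_fst (2 * s) le_rfl).swap using 1 <;> omega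

theorem grow (h : TiesReachable r s) : TiesReachable (r + s) (s + 1) := by
  constructor
  · have := h.2.outward (by omega) le_rfl
    have := Reachable.run_to_tie_snd (d := r) (2 * s + 1) this (by omega)
    convert this using 1 <;> omega
  · have := h.1.inward le_rfl (by omega)
    have := (Reachable.run_to_tie_fst (b := r) (2 * s + 1) this (by omega)).swap
    convert this using 1 <;> omega

theorem one (r : ℕ) : TiesReachable r 1 := by
  induction r with
  | zero => exact zero.grow
  | succ r ih => exact ih.rotate

theorem add_sum_range (e s : ℕ) :
    TiesReachable (e + ∑ i ∈ Finset.range (s + 1), i) (s + 1) := by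
  induction s with
  | zero => simpa using one e
  | succ s ih =>
    rw [Finset.sum_range_succ, ← add_assoc]
    exact ih.grow

end TiesReachable

/-- For every `T ≥ 1`, with `k` the largest natural number satisfying
`k(2k−1) ≤ T`, there exists a dynamic `(U, V)` for `I₂` such that
`U(2T) = (T, T)` and the multiset of components of `V(2T)` is
`{T − (2k−1), T + (2k−1)}`; in particular `gap(2T) = 2k−1`. -/
theorem stmt_15 (T : ℕ) (hT : 1 ≤ T) (k : ℕ)
    (hk : k * (2 * k - 1) ≤ T)
    (hkmax : ∀ m : ℕ, m * (2 * m - 1) ≤ T → m ≤ k) :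
    ∃ U V : ℕ → Fin 2 → ℕ, IsDynamic 2 U V ∧
      U (2 * T) 0 = T ∧ U (2 * T) 1 = T ∧
      ({V (2 * T) 0, V (2 * T) 1} : Multiset ℕ) =
        {T - (2 * k - 1), T + (2 * k - 1)} ∧
      gap 2 U V (2 * T) = 2 * (k : ℤ) - 1 := by
  have hk1 : 1 ≤ k := hkmax 1 (by omega)
  obtain ⟨j, rfl⟩ : ∃ j, k = j + 1 := ⟨k - 1, by omega⟩
  have hj : 2 * (j + 1) - 1 = 2 * j + 1 := by omega
  rw [hj] at hk ⊢
  have hsum : ∑ i ∈ Finset.range (2 * j + 1), i = (2 * j + 1) * j := by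
    have := Finset.sum_range_id_mul_two (2 * j + 1)
    simp only [Nat.add_sub_cancel] at this
    linarith
  obtain ⟨e, rfl⟩ := Nat.exists_eq_add_of_le hk
  have hT' : (j + 1) * (2 * j + 1) + e = e + (2 * j + 1) * j + (2 * j + 1) := by ring
  obtain ⟨U, V, hD, hU, hV⟩ := (TiesReachable.add_sum_range e (2 * j)).2
  rw [hsum] at hU hV
  rw [hT']
  generalize e + (2 * j + 1) * j = r at *
  refine ⟨U, V, hD, by simp [hU], by simp [hU], ?_, ?_⟩
  · rw [hV, Multiset.pair_comm]
    simp only [Matrix.cons_val_zero, Matrix.cons_val_one, Nat.add_sub_cancel]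
    congr 2
    omega
  · have hsup : ⨆ l, V (2 * (r + (2 * j + 1))) l = r + 2 * (2 * j + 1) := by
      refine le_antisymm (ciSup_le ?_) ?_
      · simp [hV, Fin.forall_fin_two]
      · simpa [hV] using le_ciSup (Finite.bddAbove_range (V (2 * (r + (2 * j + 1))))) 0
    have hinf : ⨅ l, U (2 * (r + (2 * j + 1))) l = r + (2 * j + 1) := by
      have : ∀ l, U (2 * (r + (2 * j + 1))) l = r + (2 * j + 1) := by
        simp [hU, Fin.forall_fin_two]
      simp only [this, ciInf_const]
    rw [gap, hsup, hinf]
    push_cast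
    ring
end
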